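/- arXiv:math/0410139 — 3 statements merged into one kernel-verified Lean document; each statement's English description precedes it below -/
import Mathlib

section
/- Let G be a centered ℝ^d-valued Gaussian random vector with covariance matrix V and support all of ℝ^d, and let λ be the minimal eigenvalue of V. Then there exists a constant c_d depending only on d such that for every ε > 0 and every convex set C ⊆ ℝ^d, P(G ∈ C^ε \ C^{−ε}) ≤ 2 c_d λ^{−1/2} ε, where C^ε = ⋃_{x ∈ C} B(x, ε) is the open ε-enlargement of C and C^{−ε} = {x : B(x, ε) ⊆ C} is the ε-shrinkage of C (B(x, ε) being the open Euclidean ball of radius ε around x). -/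
open MeasureTheory ProbabilityTheory Filter Set
open scoped ENNReal NNReal RealInnerProductSpace

noncomputable section

/-- In finite dimension, a point outside a convex set is weakly separated from it by a nonzero
functional, whether or not the set has interior. -/
theorem Convex.exists_strongDual_ne_zero_forall_le {E : Type*} [NormedAddCommGroup E]
    [NormedSpace ℝ E] [FiniteDimensional ℝ E] {C : Set E} (hC : Convex ℝ C) (hne : C.Nonempty)
    {y : E} (hy : y ∉ C) : ∃ f : StrongDual ℝ E, f ≠ 0 ∧ ∀ c ∈ C, f c ≤ f y := by
  by_cases hint : (interior C).Nonempty
  · exact geometric_hahn_banach_of_nonempty_interior_point hC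
      (fun h => hy (interior_subset h)) hint
  obtain ⟨c₀, hc₀⟩ := hne
  have hdir : (affineSpan ℝ C).direction < ⊤ := by
    rw [hC.interior_nonempty_iff_affineSpan_eq_top] at hint
    rwa [lt_top_iff_ne_top, Ne, AffineSubspace.direction_eq_top_iff_of_nonempty
      ⟨c₀, subset_affineSpan ℝ C hc₀⟩]
  obtain ⟨f, hf0, hf⟩ := Submodule.exists_le_ker_of_lt_top _ hdir
  have hconst : ∀ c ∈ C, f c = f c₀ := fun c hc => by
    have := hf (AffineSubspace.vsub_mem_direction (subset_affineSpan ℝ C hc)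
      (subset_affineSpan ℝ C hc₀))
    simpa [sub_eq_zero] using this
  have hg0 : f.toContinuousLinearMap ≠ 0 := by simpa using hf0
  rcases le_total (f c₀) (f y) with h | h
  · exact ⟨f.toContinuousLinearMap, hg0, fun c hc => by simpa [hconst c hc] using h⟩
  · exact ⟨-f.toContinuousLinearMap, neg_ne_zero.mpr hg0,
      fun c hc => by simpa [hconst c hc] using h⟩

/-- The density of a nondegenerate real Gaussian measure of variance `v` is at most `1 / √v`. -/
theorem gaussianReal_apply_le_volume (m : ℝ) {v : ℝ≥0} (hv : v ≠ 0) (S : Set ℝ) :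
    gaussianReal m v S ≤ ENNReal.ofReal (1 / √v) * volume S := by
  rw [gaussianReal_apply m hv, ← setLIntegral_const]
  refine lintegral_mono fun x => ENNReal.ofReal_le_ofReal ?_
  have hv' : (0 : ℝ) < v := by positivity
  rw [gaussianPDFReal, one_div]
  refine (mul_le_of_le_one_right (by positivity) (Real.exp_le_one_iff.mpr ?_)).trans ?_
  · exact div_nonpos_of_nonpos_of_nonneg (neg_nonpos.mpr (sq_nonneg _)) (by positivity)
  · gcongr
    nlinarith [Real.pi_gt_three]

section Gaussian

variable {E : Type*} [NormedAddCommGroup E] [InnerProductSpace ℝ E] [FiniteDimensional ℝ E]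
  [MeasurableSpace E] [BorelSpace E]

/-- A measurable set that meets every line of direction `w` in a set of diameter at most `s` has
Gaussian measure at most `s / √lam`, where `lam` bounds the covariance from below. -/
theorem IsGaussian.measure_le_of_forall_add_smul_notMem (γ : Measure E) [IsGaussian γ]
    (V : E →ₗ[ℝ] E) {lam : ℝ} (hlam : 0 < lam)
    (hcov : ∀ u v, cov[fun x => ⟪x, u⟫, fun x => ⟪x, v⟫; γ] = ⟪V u, v⟫)
    (hV : ∀ x, lam * ‖x‖ ^ 2 ≤ ⟪V x, x⟫) {w : E} (hw : ‖w‖ = 1) {A : Set E}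
    (hA : MeasurableSet A) {s : ℝ} (hs : ∀ x ∈ A, ∀ t, s ≤ t → x + t • w ∉ A) :
    γ A ≤ ENNReal.ofReal (s / √lam) := by
  have hinj : Function.Injective V := by
    rw [← LinearMap.ker_eq_bot, LinearMap.ker_eq_bot']
    intro x hx
    have h := hV x
    rw [hx, inner_zero_left] at h
    have : ‖x‖ ^ 2 ≤ 0 := by nlinarith
    simpa using this
  obtain ⟨b, hb⟩ := LinearMap.surjective_of_injective hinj w
  have hb0 : b ≠ 0 := by
    rintro rfl
    rw [map_zero] at hb
    simp [← hb] at hw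
  have hwb : 0 < ⟪w, b⟫ := by
    have h := hV b
    rw [hb] at h
    have : 0 < ‖b‖ := norm_pos_iff.mpr hb0
    exact lt_of_lt_of_le (by positivity) h
  -- `a` is the functional whose component `⟪x, a⟫ • w` is independent of the remainder of `x`
  obtain ⟨a, ha⟩ : ∃ a, a = ⟪w, b⟫⁻¹ • b := ⟨_, rfl⟩
  have hVa : V a = ⟪w, b⟫⁻¹ • w := by rw [ha, map_smul, hb]
  have hwa : ⟪w, a⟫ = 1 := by
    rw [ha, inner_smul_right, inv_mul_cancel₀ hwb.ne']
  have hlamvar : lam ≤ ⟪V a, a⟫ := by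
    refine le_trans ?_ (hV a)
    have h1 : 1 ≤ ‖a‖ := by
      have := real_inner_le_norm w a
      rwa [hwa, hw, one_mul] at this
    nlinarith [one_le_pow₀ h1 (n := 2)]
  let Y : E →L[ℝ] ℝ := innerSL ℝ a
  let R : E →L[ℝ] E := ContinuousLinearMap.id ℝ E - Y.smulRight w
  have hY : ∀ x, Y x = ⟪x, a⟫ := fun x => by simp [Y, real_inner_comm]
  have hR : ∀ x, R x = x - ⟪x, a⟫ • w := fun x => by simp [R, hY]
  have hid : HasGaussianLaw (id : E → E) γ := IsGaussian.hasGaussianLaw_id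
  have hjoint : HasGaussianLaw (fun x => (R x, Y x)) γ := hid.map_fun (R.prod Y)
  have hind : IndepFun R Y γ := by
    refine hjoint.indepFun_of_covariance_inner fun z r => ?_
    have e1 : (fun x => ⟪z, R x⟫) = fun x => ⟪x, z - ⟪z, w⟫ • a⟫ := by
      ext x
      rw [hR, inner_sub_right, inner_sub_right, inner_smul_right, inner_smul_right,
        real_inner_comm z x]
      ring
    have e2 : (fun x => ⟪r, Y x⟫) = fun x => r * ⟪x, a⟫ := by
      ext x
      simp [hY, mul_comm]
    rw [e1, e2, covariance_const_mul_right, covariance_comm, hcov, hVa, inner_sub_right,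
      inner_smul_right, inner_smul_left, inner_smul_left, hwa, real_inner_comm z w]
    simp [mul_comm]
  have hmap : γ.map (fun x => (R x, Y x)) = (γ.map R).prod (γ.map Y) :=
    (indepFun_iff_map_prod_eq_prod_map_map (by fun_prop) (by fun_prop)).mp hind
  let B : Set (E × ℝ) := (fun p => p.1 + p.2 • w) ⁻¹' A
  have hB : MeasurableSet B :=
    (by fun_prop : Measurable fun p : E × ℝ => p.1 + p.2 • w) hA
  have hAB : (fun x => (R x, Y x)) ⁻¹' B = A := by
    ext x
    simp [B, hR, hY]
  have hYlaw : γ.map Y = gaussianReal γ[Y] ⟪V a, a⟫.toNNReal := by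
    rw [IsGaussian.map_eq_gaussianReal Y, ← hcov, ← covariance_self (by fun_prop)]
    simp only [← hY]
  have hvar0 : ⟪V a, a⟫.toNNReal ≠ 0 := by simpa using hlam.trans_le hlamvar
  have hsec : ∀ r, γ.map Y (Prod.mk r ⁻¹' B) ≤ ENNReal.ofReal (s / √lam) := fun r => by
    have hvol : volume (Prod.mk r ⁻¹' B) ≤ ENNReal.ofReal s := by
      refine (Real.volume_le_diam _).trans (Metric.ediam_le fun t ht t' ht' => ?_)
      have key : ∀ p q : ℝ, r + p • w ∈ A → r + q • w ∈ A → q - p ≤ s := fun p q hp hq => by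
        by_contra! h
        refine hs _ hp (q - p) h.le ?_
        rwa [add_assoc, ← add_smul, add_sub_cancel]
      rw [edist_dist]
      refine ENNReal.ofReal_le_ofReal ?_
      rw [Real.dist_eq, abs_le]
      exact ⟨by linarith [key t t' ht ht'], key t' t ht' ht⟩
    rw [hYlaw]
    refine (gaussianReal_apply_le_volume _ hvar0 _).trans ?_
    rw [div_eq_inv_mul s, ENNReal.ofReal_mul (by positivity), ← one_div]
    refine mul_le_mul' (ENNReal.ofReal_le_ofReal ?_) hvol
    rw [Real.coe_toNNReal _ (hlam.le.trans hlamvar)]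
    gcongr
  have : IsProbabilityMeasure (γ.map R) := Measure.isProbabilityMeasure_map (by fun_prop)
  calc γ A = γ.map (fun x => (R x, Y x)) B := by rw [Measure.map_apply (by fun_prop) hB, hAB]
    _ = ∫⁻ r, γ.map Y (Prod.mk r ⁻¹' B) ∂γ.map R := by rw [hmap, Measure.prod_apply hB]
    _ ≤ ∫⁻ _, ENNReal.ofReal (s / √lam) ∂γ.map R := lintegral_mono hsec
    _ = ENNReal.ofReal (s / √lam) := by simp

end Gaussian

/-- The points of `U` that leave `U` under translation by `v`. -/
def exitSet {E : Type*} [Add E] (U : Set E) (v : E) : Set E := {x ∈ U | x + v ∉ U}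

theorem Convex.add_smul_notMem_exitSet {E : Type*} [AddCommGroup E] [Module ℝ E] {U : Set E}
    (hU : Convex ℝ U) {w : E} {s : ℝ} (hs : 0 < s) {x : E} (hx : x ∈ exitSet U (s • w)) {t : ℝ}
    (ht : s ≤ t) : x + t • w ∉ exitSet U (s • w) := by
  intro h
  refine hx.2 ?_
  have ht0 : 0 < t := hs.trans_le ht
  have := hU.add_smul_mem hx.1 h.1 (t := s / t) ⟨by positivity, (div_le_one ht0).mpr ht⟩
  rwa [smul_smul, div_mul_cancel₀ _ ht0.ne'] at this

theorem IsOpen.measurableSet_exitSet {E : Type*} [NormedAddCommGroup E] [MeasurableSpace E]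
    [BorelSpace E] {U : Set E} (hU : IsOpen U) (v : E) : MeasurableSet (exitSet U v) :=
  hU.measurableSet.inter ((hU.preimage (continuous_add_const v)).measurableSet.compl)

theorem EuclideanSpace.exists_norm_le_card_mul_abs {d : ℕ} {u : EuclideanSpace ℝ (Fin d)}
    (hu : u ≠ 0) : ∃ i, ‖u‖ ≤ d * |u i| := by
  have hsum : ‖u‖ ≤ ∑ i, |u i| := by
    rw [EuclideanSpace.norm_eq, Real.sqrt_le_left (Finset.sum_nonneg fun i _ => abs_nonneg _)]
    exact Finset.sum_sq_le_sq_sum_of_nonneg fun i _ => abs_nonneg _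
  by_contra! h
  have : Nonempty (Fin d) := by
    by_contra he
    rw [not_nonempty_iff] at he
    exact hu (Subsingleton.elim _ _)
  have h2 := Finset.sum_lt_sum_of_nonempty Finset.univ_nonempty fun i (_ : i ∈ Finset.univ) => h i
  simp only [Finset.sum_const, Finset.card_univ, Fintype.card_fin, nsmul_eq_mul,
    ← Finset.mul_sum] at h2
  have hd : (0 : ℝ) < d := by exact_mod_cast Fin.pos_iff_nonempty.mpr this
  exact absurd hsum (not_le.mpr (lt_of_mul_lt_mul_left h2 hd.le))

/-- A point within `ε` of both a convex set and its complement leaves the `ε`-enlargement of the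
set when it is moved by `2dε` along some signed coordinate direction. -/
theorem Convex.thickening_diff_subset_iUnion_exitSet {d : ℕ} {C : Set (EuclideanSpace ℝ (Fin d))}
    (hC : Convex ℝ C) {ε : ℝ} (hε : 0 < ε) :
    Metric.thickening ε C \ {x | Metric.ball x ε ⊆ C} ⊆
      ⋃ p : Fin d × ℤˣ, exitSet (Metric.thickening ε C)
        ((2 * d * ε) • (((p.2 : ℤ) : ℝ) • EuclideanSpace.single p.1 (1 : ℝ))) := by
  rintro x ⟨hx, hxC⟩
  obtain ⟨y, hyx, hyC⟩ := Set.not_subset.mp hxC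
  obtain ⟨c₀, hc₀, -⟩ := Metric.mem_thickening_iff.mp hx
  obtain ⟨f, hf0, hf⟩ := hC.exists_strongDual_ne_zero_forall_le ⟨c₀, hc₀⟩ hyC
  obtain ⟨u, rfl⟩ := (InnerProductSpace.toDual ℝ (EuclideanSpace ℝ (Fin d))).surjective f
  simp only [InnerProductSpace.toDual_apply_apply] at hf
  have hu : u ≠ 0 := by
    rintro rfl
    simp at hf0
  have hupos : 0 < ‖u‖ := norm_pos_iff.mpr hu
  obtain ⟨i, hi⟩ := EuclideanSpace.exists_norm_le_card_mul_abs hu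
  obtain ⟨σ, hσ⟩ : ∃ σ : ℤˣ, ((σ : ℤ) : ℝ) * u i = |u i| := by
    rcases abs_cases (u i) with h | h
    · exact ⟨1, by simp [h.1]⟩
    · exact ⟨-1, by simp [h.1]⟩
  refine Set.mem_iUnion.mpr ⟨(i, σ), hx, fun hmem => ?_⟩
  obtain ⟨c, hc, hdist⟩ := Metric.mem_thickening_iff.mp hmem
  have hlip : ∀ p q : EuclideanSpace ℝ (Fin d), dist p q < ε → ⟪u, p⟫ - ⟪u, q⟫ < ‖u‖ * ε :=
    fun p q h => by
      rw [← inner_sub_right]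
      refine (real_inner_le_norm _ _).trans_lt ?_
      rw [← dist_eq_norm]
      gcongr
  have h1 := hlip _ _ hdist
  have h2 := hlip _ _ (Metric.mem_ball.mp hyx)
  have h3 := hf c hc
  have h4 : ⟪u, x + (2 * d * ε) • (((σ : ℤ) : ℝ) • EuclideanSpace.single i (1 : ℝ))⟫ =
      ⟪u, x⟫ + 2 * ε * (d * |u i|) := by
    rw [inner_add_right, inner_smul_right, inner_smul_right, EuclideanSpace.inner_single_right,
      ← hσ]
    simp
    ring
  rw [h4] at h1
  nlinarith

/-- **Lemma 10 of Einmahl–Kuelbs.**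
For a centered `ℝ^d`-valued Gaussian vector `G` with covariance `V` of full support and
minimal eigenvalue `λ`, there is a constant `c_d` depending only on `d` such that for every
`ε > 0` and every convex `C`, `P(G ∈ C^ε \ C^{-ε}) ≤ 2 c_d λ^{-1/2} ε`. -/
theorem statement12 (d : ℕ) :
    ∃ c : ℝ, 0 < c ∧
      ∀ (γ : Measure (EuclideanSpace ℝ (Fin d))), IsProbabilityMeasure γ →
      ∀ (V : EuclideanSpace ℝ (Fin d) →ₗ[ℝ] EuclideanSpace ℝ (Fin d)) (lam : ℝ),
        -- `γ` is centered Gaussian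
        (∀ v : EuclideanSpace ℝ (Fin d), ∃ s : ℝ≥0,
          γ.map (fun x => (⟪x, v⟫ : ℝ)) = gaussianReal 0 s) →
        -- `V` is the covariance of `γ`
        (∀ u v : EuclideanSpace ℝ (Fin d),
          (∫ x, (⟪x, u⟫ : ℝ) * (⟪x, v⟫ : ℝ) ∂γ) = ⟪V u, v⟫) →
        -- the support of `γ` is all of `ℝ^d`
        (∀ U : Set (EuclideanSpace ℝ (Fin d)), IsOpen U → U.Nonempty → 0 < γ U) →
        -- `lam` is the minimal eigenvalue of `V`
        0 < lam →
        (∀ x : EuclideanSpace ℝ (Fin d), lam * ‖x‖ ^ 2 ≤ ⟪V x, x⟫) →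
        (∃ x : EuclideanSpace ℝ (Fin d), ‖x‖ = 1 ∧ (⟪V x, x⟫ : ℝ) = lam) →
        ∀ ε : ℝ, 0 < ε → ∀ C : Set (EuclideanSpace ℝ (Fin d)), Convex ℝ C →
          γ (Metric.thickening ε C \ {x | Metric.ball x ε ⊆ C}) ≤
            ENNReal.ofReal (2 * c * ε / Real.sqrt lam) := by
  refine ⟨2 * d ^ 2 + 1, by positivity, ?_⟩
  intro γ _ V lam hgauss hcov _ hlam hV _ ε hε C hC
  have hG : IsGaussian γ := isGaussian_of_map_eq_gaussianReal fun L => by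
    obtain ⟨s, hs⟩ := hgauss ((InnerProductSpace.toDual ℝ _).symm L)
    refine ⟨0, s, ?_⟩
    rw [← hs]
    congr 1
    ext x
    rw [real_inner_comm, InnerProductSpace.toDual_symm_apply]
  have hmean : ∀ u, ∫ x, ⟪x, u⟫ ∂γ = 0 := fun u => by
    obtain ⟨s, hs⟩ := hgauss u
    rw [← integral_id_gaussianReal (μ := 0) (v := s), ← hs,
      integral_map (by fun_prop) (by fun_prop)]
  have hcov' : ∀ u v, cov[fun x => ⟪x, u⟫, fun x => ⟪x, v⟫; γ] = ⟪V u, v⟫ := fun u v => by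
    rw [covariance, hmean, hmean, ← hcov]
    simp only [sub_zero]
  have hbound : ∀ p : Fin d × ℤˣ, γ (exitSet (Metric.thickening ε C)
      ((2 * d * ε) • (((p.2 : ℤ) : ℝ) • EuclideanSpace.single p.1 (1 : ℝ)))) ≤
        ENNReal.ofReal (2 * d * ε / √lam) := fun p => by
    have hd : (0 : ℝ) < d := by exact_mod_cast p.1.pos
    refine IsGaussian.measure_le_of_forall_add_smul_notMem γ V hlam hcov' hV ?_
      (Metric.isOpen_thickening.measurableSet_exitSet _)
      fun x hx t ht => (hC.thickening ε).add_smul_notMem_exitSet (by positivity) hx ht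
    rcases Int.units_eq_one_or p.2 with h | h <;> simp [h]
  calc γ (Metric.thickening ε C \ {x | Metric.ball x ε ⊆ C})
      ≤ ∑ _p : Fin d × ℤˣ, ENNReal.ofReal (2 * d * ε / √lam) :=
        (measure_mono (hC.thickening_diff_subset_iUnion_exitSet hε)).trans
          ((measure_iUnion_fintype_le _ _).trans (Finset.sum_le_sum fun p _ => hbound p))
    _ = ENNReal.ofReal (2 * d * (2 * d * ε / √lam)) := by
        rw [ENNReal.ofReal_mul (by positivity)]
        simp [ENNReal.ofReal_mul, mul_comm]
    _ ≤ ENNReal.ofReal (2 * (2 * d ^ 2 + 1) * ε / √lam) := by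
        refine ENNReal.ofReal_le_ofReal ?_
        rw [← mul_div_assoc]
        refine div_le_div_of_nonneg_right ?_ (Real.sqrt_nonneg _)
        nlinarith
end
end

section
/- Let Z₁ and Z₂ be independent real-valued random variables and let c, d > 0. Then P(Z₁ ≥ c Z₂, Z₂ ≥ 0) ≤ r₂(d)[P(Z₁ ≥ 0) + E(Z₁⁺)/(c d)], where r₂(d) = sup_{x ≥ 0} P(x ≤ Z₂ < x + d) and Z₁⁺ = max(Z₁, 0). -/
open MeasureTheory ProbabilityTheory Filter Set
open scoped ENNReal NNReal

noncomputable section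

/-- If every half-open interval of length `d` starting in `[0, ∞)` has mass at most `r`,
then `[0, n d)` has mass at most `n r`. -/
lemma measureReal_Ico_nat_mul_le (ν : Measure ℝ) [IsFiniteMeasure ν] {d r : ℝ} (hd : 0 < d)
    (hr : ∀ x, 0 ≤ x → ν.real (Ico x (x + d)) ≤ r) (n : ℕ) :
    ν.real (Ico 0 (n * d)) ≤ n * r := by
  induction n with
  | zero => simp
  | succ n ih =>
    have hn : (0 : ℝ) ≤ n * d := by positivity
    have hcast : ((n + 1 : ℕ) : ℝ) * d = n * d + d := by push_cast; ring
    rw [hcast, ← Ico_union_Ico_eq_Ico hn (by linarith)]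
    calc ν.real (Ico 0 (n * d) ∪ Ico (n * d) (n * d + d))
        ≤ ν.real (Ico 0 (n * d)) + ν.real (Ico (n * d) (n * d + d)) := measureReal_union_le _ _
      _ ≤ n * r + r := add_le_add ih (hr _ hn)
      _ = ((n + 1 : ℕ) : ℝ) * r := by push_cast; ring

lemma measureReal_Icc_le_mul_one_add_div (ν : Measure ℝ) [IsFiniteMeasure ν] {d r y : ℝ}
    (hd : 0 < d) (hr : ∀ x, 0 ≤ x → ν.real (Ico x (x + d)) ≤ r) (hy : 0 ≤ y) :
    ν.real (Icc 0 y) ≤ r * (1 + y / d) := by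
  have hr0 : 0 ≤ r := measureReal_nonneg.trans (hr 0 le_rfl)
  have hlt : y < (⌊y / d⌋₊ + 1 : ℕ) * d := by
    have := Nat.lt_floor_add_one (y / d)
    rw [div_lt_iff₀ hd] at this
    exact_mod_cast this
  calc ν.real (Icc 0 y) ≤ ν.real (Ico 0 ((⌊y / d⌋₊ + 1 : ℕ) * d)) :=
        measureReal_mono (Icc_subset_Ico_right hlt)
    _ ≤ (⌊y / d⌋₊ + 1 : ℕ) * r := measureReal_Ico_nat_mul_le ν hd hr _
    _ ≤ r * (1 + y / d) := by
        have := Nat.floor_le (div_nonneg hy hd.le)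
        push_cast
        nlinarith

/-- For independent `X` and `Y`, the probability of `(X, Y) ∈ S` is bounded by the expectation
of any bound on the `Y`-probabilities of the sections of `S` along `X`. -/
lemma measureReal_preimage_le_integral_of_indepFun {Ω α β : Type*} [MeasurableSpace Ω]
    [MeasurableSpace α] [MeasurableSpace β] {P : Measure Ω} [IsFiniteMeasure P]
    {X : Ω → α} {Y : Ω → β} (hX : Measurable X) (hY : Measurable Y) (h : IndepFun X Y P)
    {S : Set (α × β)} (hS : MeasurableSet S) {g : Ω → ℝ} (hg : Integrable g P)
    (hle : ∀ ω, (P.map Y).real (Prod.mk (X ω) ⁻¹' S) ≤ g ω) :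
    P.real ((fun ω => (X ω, Y ω)) ⁻¹' S) ≤ ∫ ω, g ω ∂P := by
  have hg0 : ∀ ω, 0 ≤ g ω := fun ω => measureReal_nonneg.trans (hle ω)
  refine ENNReal.toReal_le_of_le_ofReal (integral_nonneg hg0) ?_
  rw [← Measure.map_apply (hX.prodMk hY) hS,
    (indepFun_iff_map_prod_eq_prod_map_map hX.aemeasurable hY.aemeasurable).1 h,
    Measure.prod_apply hS, lintegral_map (measurable_measure_prodMk_left hS) hX,
    ofReal_integral_eq_lintegral_ofReal hg (ae_of_all _ hg0)]
  refine lintegral_mono fun ω => ?_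
  rw [← ofReal_measureReal]
  exact ENNReal.ofReal_le_ofReal (hle ω)

/-- **Lemma 13 of Einmahl–Kuelbs.**
For independent real random variables `Z₁, Z₂` and `c, d > 0`:
`P(Z₁ ≥ c Z₂, Z₂ ≥ 0) ≤ r₂(d)[P(Z₁ ≥ 0) + E(Z₁⁺)/(cd)]`,
where `r₂(d) = sup_{x ≥ 0} P(x ≤ Z₂ < x + d)`. -/
theorem statement16
    {Ω : Type*} [MeasurableSpace Ω]
    (P : Measure Ω) [IsProbabilityMeasure P]
    (Z₁ Z₂ : Ω → ℝ) (hZ₁ : Measurable Z₁) (hZ₂ : Measurable Z₂)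
    (hindep : IndepFun Z₁ Z₂ P)
    (hint : Integrable (fun ω => max (Z₁ ω) 0) P)
    (c d : ℝ) (hc : 0 < c) (hd : 0 < d) :
    (P {ω | c * Z₂ ω ≤ Z₁ ω ∧ 0 ≤ Z₂ ω}).toReal ≤
      (⨆ x : {x : ℝ // 0 ≤ x}, (P {ω | (x : ℝ) ≤ Z₂ ω ∧ Z₂ ω < (x : ℝ) + d}).toReal) *
        ((P {ω | 0 ≤ Z₁ ω}).toReal + (∫ ω, max (Z₁ ω) 0 ∂P) / (c * d)) := by
  let r : ℝ := ⨆ x : {x : ℝ // 0 ≤ x}, (P {ω | (x : ℝ) ≤ Z₂ ω ∧ Z₂ ω < (x : ℝ) + d}).toReal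
  have := Measure.isProbabilityMeasure_map (μ := P) hZ₂.aemeasurable
  have hr : ∀ x, 0 ≤ x → (P.map Z₂).real (Ico x (x + d)) ≤ r := by
    intro x hx
    rw [map_measureReal_apply hZ₂ measurableSet_Ico]
    refine le_ciSup (f := fun x : {x : ℝ // 0 ≤ x} =>
      (P {ω | (x : ℝ) ≤ Z₂ ω ∧ Z₂ ω < (x : ℝ) + d}).toReal) ⟨1, ?_⟩ ⟨x, hx⟩
    rintro _ ⟨y, rfl⟩
    exact measureReal_le_one
  have hA : MeasurableSet {ω | 0 ≤ Z₁ ω} := measurableSet_le measurable_const hZ₁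
  have hind : Integrable ({ω | 0 ≤ Z₁ ω}.indicator (1 : Ω → ℝ)) P :=
    (integrable_const (1 : ℝ)).indicator hA
  have hS : MeasurableSet {p : ℝ × ℝ | c * p.2 ≤ p.1 ∧ 0 ≤ p.2} :=
    MeasurableSet.inter (measurableSet_le (measurable_snd.const_mul c) measurable_fst)
      (measurableSet_le measurable_const measurable_snd)
  have key := measureReal_preimage_le_integral_of_indepFun hZ₁ hZ₂ hindep hS
    ((hind.add (hint.div_const (c * d))).const_mul r) fun ω => by
      by_cases h : 0 ≤ Z₁ ω
      · have hsec : Prod.mk (Z₁ ω) ⁻¹' {p : ℝ × ℝ | c * p.2 ≤ p.1 ∧ 0 ≤ p.2}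
            = Icc 0 (Z₁ ω / c) := by
          ext y
          simp [le_div_iff₀ hc, mul_comm, and_comm]
        rw [hsec]
        simpa [h, div_div] using
          measureReal_Icc_le_mul_one_add_div (P.map Z₂) hd hr (div_nonneg h hc.le)
      · have hsec : Prod.mk (Z₁ ω) ⁻¹' {p : ℝ × ℝ | c * p.2 ≤ p.1 ∧ 0 ≤ p.2} = ∅ := by
          ext y
          simp only [mem_preimage, mem_ofPred_eq, mem_empty_iff_false, iff_false, not_and]
          intro h1 h2
          exact h ((mul_nonneg hc.le h2).trans h1)
        rw [hsec]
        simp [h, max_eq_right (not_le.1 h).le]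
  rw [integral_const_mul, integral_add' hind (hint.div_const _), integral_indicator_one hA,
    integral_div] at key
  exact key
end
end

section
/- Let W and W̄ be real-valued random variables and suppose sup_{u ∈ ℝ} |P(W ≥ u) − P(W̄ ≥ u)| ≤ ε for some ε ≥ 0. Then for every c > 0, |E[exp(−c W) 1{W > 0}] − E[exp(−c W̄) 1{W̄ > 0}]| ≤ 2ε. -/
open MeasureTheory ProbabilityTheory Filter Set
open scoped ENNReal NNReal

noncomputable section

lemma tendsto_measureReal_le_of_strictAnti
    {Ω : Type*} [MeasurableSpace Ω] (P : Measure Ω) [IsFiniteMeasure P] (W : Ω → ℝ)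
    {u : ℕ → ℝ} {a : ℝ} (hu : StrictAnti u) (hu_lim : Tendsto u atTop (nhds a)) :
    Tendsto (fun n => P.real {ω | u n ≤ W ω}) atTop (nhds (P.real {ω | a < W ω})) := by
  have hmono : Monotone fun n => {ω | u n ≤ W ω} :=
    fun m n hmn ω hω => (hu.antitone hmn).trans hω
  have hunion : (⋃ n, {ω | u n ≤ W ω}) = {ω | a < W ω} := by
    ext ω
    simp only [mem_iUnion, mem_ofPred_eq]
    refine ⟨fun ⟨n, hn⟩ => ?_, fun hω => (hu_lim.eventually_le_const hω).exists⟩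
    exact ((hu.antitone.le_of_tendsto hu_lim (n + 1)).trans_lt (hu n.lt_succ_self)).trans_le hn
  have hlim := tendsto_measure_iUnion_atTop (μ := P) hmono
  rw [hunion] at hlim
  exact (ENNReal.tendsto_toReal (measure_ne_top _ _)).comp hlim

/-- A bound on the difference of the closed upper tails passes to the open upper tails. -/
lemma abs_measureReal_lt_sub_le
    {Ω : Type*} [MeasurableSpace Ω] {Ω' : Type*} [MeasurableSpace Ω']
    {P : Measure Ω} [IsFiniteMeasure P] {P' : Measure Ω'} [IsFiniteMeasure P']
    {W : Ω → ℝ} {W' : Ω' → ℝ} {ε : ℝ}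
    (h : ∀ u : ℝ, |P.real {ω | u ≤ W ω} - P'.real {ω | u ≤ W' ω}| ≤ ε) (a : ℝ) :
    |P.real {ω | a < W ω} - P'.real {ω | a < W' ω}| ≤ ε := by
  obtain ⟨u, hu, -, hu_lim⟩ := exists_seq_strictAnti_tendsto a
  exact le_of_tendsto ((tendsto_measureReal_le_of_strictAnti P W hu hu_lim).sub
    (tendsto_measureReal_le_of_strictAnti P' W' hu hu_lim)).abs
    (Eventually.of_forall fun n => h (u n))

/-- Layer-cake formula for the Laplace transform of the positive part of a distribution. -/
lemma setIntegral_exp_neg_mul_eq_integral_measureReal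
    {Ω : Type*} [MeasurableSpace Ω] {P : Measure Ω} [IsFiniteMeasure P]
    {W : Ω → ℝ} (hW : Measurable W) {c : ℝ} (hc : 0 < c) :
    IntegrableOn (fun t => P.real {ω | 0 < W ω} - P.real {ω | -Real.log t / c < W ω})
        (Ioc 0 1) ∧
      ∫ ω in {ω | 0 < W ω}, Real.exp (-(c * W ω)) ∂P =
        ∫ t in Ioc (0 : ℝ) 1,
          (P.real {ω | 0 < W ω} - P.real {ω | -Real.log t / c < W ω}) := by
  have hpos : MeasurableSet {ω | 0 < W ω} := measurableSet_lt measurable_const hW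
  have hmeas : Measurable fun ω => Real.exp (-(c * W ω)) := by fun_prop
  have hle : (fun ω => Real.exp (-(c * W ω))) ≤ᵐ[P.restrict {ω | 0 < W ω}] fun _ => 1 := by
    filter_upwards [ae_restrict_mem hpos] with ω hω
    exact Real.exp_le_one_iff.mpr (neg_nonpos.mpr (mul_pos hc hω).le)
  have hint : Integrable (fun ω => Real.exp (-(c * W ω))) (P.restrict {ω | 0 < W ω}) := by
    refine Integrable.of_bound hmeas.aestronglyMeasurable 1 ?_
    filter_upwards [hle] with ω hω
    rwa [Real.norm_of_nonneg (Real.exp_pos _).le]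
  have hlevel : EqOn
      (fun t => (P.restrict {ω | 0 < W ω}).real {ω | t ≤ Real.exp (-(c * W ω))})
      (fun t => P.real {ω | 0 < W ω} - P.real {ω | -Real.log t / c < W ω}) (Ioc 0 1) := by
    intro t ht
    have hnonneg : 0 ≤ -Real.log t / c :=
      div_nonneg (neg_nonneg.mpr (Real.log_nonpos ht.1.le ht.2)) hc.le
    have hsub : {ω | -Real.log t / c < W ω} ⊆ {ω | 0 < W ω} :=
      fun ω hω => hnonneg.trans_lt hω
    have hset : {ω | t ≤ Real.exp (-(c * W ω))} ∩ {ω | 0 < W ω} =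
        {ω | 0 < W ω} \ {ω | -Real.log t / c < W ω} := by
      ext ω
      simp only [mem_inter_iff, mem_ofPred_eq, Set.mem_sdiff, not_lt, ← Real.log_le_iff_le_exp ht.1,
        le_div_iff₀ hc, mul_comm c, le_neg (a := Real.log t)]
      exact and_comm
    dsimp only
    rw [measureReal_restrict_apply (measurableSet_le measurable_const hmeas), hset,
      measureReal_sdiff hsub (measurableSet_lt measurable_const hW)]
  have hanti : Antitone fun t : ℝ =>
      (P.restrict {ω | 0 < W ω}).real {ω | t ≤ Real.exp (-(c * W ω))} :=
    fun s t hst => measureReal_mono fun ω hω => hst.trans hω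
  constructor
  · refine IntegrableOn.congr_fun ?_ hlevel measurableSet_Ioc
    exact ((hanti.antitoneOn _).integrableOn_isCompact isCompact_Icc).mono_set Ioc_subset_Icc_self
  · rw [hint.integral_eq_integral_Ioc_meas_le
      (Eventually.of_forall fun ω => (Real.exp_pos _).le) hle]
    exact setIntegral_congr_fun measurableSet_Ioc hlevel

/-- **Key estimate of Lemma 16 of Einmahl–Kuelbs.**
If `sup_u |P(W ≥ u) - P(W̄ ≥ u)| ≤ ε`, then for every `c > 0`,
`|E[e^{-cW} 1{W > 0}] - E[e^{-cW̄} 1{W̄ > 0}]| ≤ 2ε`. -/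
theorem statement19
    {Ω : Type*} [MeasurableSpace Ω] {Ω' : Type*} [MeasurableSpace Ω']
    (P : Measure Ω) [IsProbabilityMeasure P] (P' : Measure Ω') [IsProbabilityMeasure P']
    (W : Ω → ℝ) (W' : Ω' → ℝ) (hW : Measurable W) (hW' : Measurable W')
    (ε : ℝ) (hε : 0 ≤ ε)
    (hsup : ∀ u : ℝ, |(P {ω | u ≤ W ω}).toReal - (P' {ω | u ≤ W' ω}).toReal| ≤ ε)
    (c : ℝ) (hc : 0 < c) :
    |(∫ ω in {ω | 0 < W ω}, Real.exp (-(c * W ω)) ∂P) -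
        ∫ ω in {ω | 0 < W' ω}, Real.exp (-(c * W' ω)) ∂P'| ≤ 2 * ε := by
  have htail := abs_measureReal_lt_sub_le hsup
  obtain ⟨hint, heq⟩ := setIntegral_exp_neg_mul_eq_integral_measureReal (P := P) hW hc
  obtain ⟨hint', heq'⟩ := setIntegral_exp_neg_mul_eq_integral_measureReal (P := P') hW' hc
  rw [heq, heq', ← integral_sub hint hint', ← Real.norm_eq_abs]
  refine (norm_setIntegral_le_of_norm_le_const (C := 2 * ε) (by simp) fun t _ => ?_).trans_eq
    (by simp)
  rw [sub_sub_sub_comm, two_mul]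
  exact (norm_sub_le _ _).trans (add_le_add (htail 0) (htail _))
end
end
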